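/- arXiv:1904.04546 — 4 statements merged into one kernel-verified Lean document; each statement's English description precedes it below -/
import Mathlib

section
/- Kantorovich duality: let μ1, μ2 be Borel probability measures on ℝ^d and let c : ℝ^d × ℝ^d → ℝ be bounded continuous. Then the supremum of ∫ c dP over all couplings P of (μ1, μ2) equals the infimum of ∫ u1 dμ1 + ∫ u2 dμ2 over all pairs of bounded continuous functions u1, u2 : ℝ^d → ℝ satisfying u1(s1) + u2(s2) ≥ c(s1, s2) for all (s1, s2) ∈ ℝ^d × ℝ^d. -/
open MeasureTheory BoundedContinuousFunction

noncomputable section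

/-- A coupling of `μ1` and `μ2`. -/
def IsCoupling {d : ℕ} (μ1 μ2 : Measure (EuclideanSpace ℝ (Fin d)))
    (P : Measure (EuclideanSpace ℝ (Fin d) × EuclideanSpace ℝ (Fin d))) : Prop :=
  P.map Prod.fst = μ1 ∧ P.map Prod.snd = μ2

open Filter Topology CompactlySupported

/-- A sublinear functional on a real vector space dominates a linear functional which agrees with
it at a prescribed point. -/
theorem exists_linearMap_le_sublinear_eq {V : Type*} [AddCommGroup V] [Module ℝ V] (N : V → ℝ)
    (N_hom : ∀ c : ℝ, 0 < c → ∀ x, N (c • x) = c * N x)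
    (N_add : ∀ x y, N (x + y) ≤ N x + N y) (v : V) :
    ∃ L : V →ₗ[ℝ] ℝ, L v = N v ∧ ∀ x, L x ≤ N x := by
  have N_zero : N 0 = 0 := by
    have h := N_hom 2 two_pos 0
    rw [smul_zero] at h
    linarith
  have H : ∀ c : ℝ, c • v = 0 → RingHom.id ℝ c • N v = 0 := by
    intro c hcv
    rcases smul_eq_zero.mp hcv with h | h <;> simp [h, N_zero]
  obtain ⟨L, hL, hLN⟩ := exists_extension_of_le_sublinear
    (LinearPMap.mkSpanSingleton' v (N v) H) N N_hom N_add (by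
      rintro ⟨x, hx⟩
      obtain ⟨c, rfl⟩ := Submodule.mem_span_singleton.mp hx
      rw [LinearPMap.mkSpanSingleton'_apply]
      simp only [RingHom.id_apply, smul_eq_mul]
      rcases lt_trichotomy c 0 with hc | rfl | hc
      · have h := N_add (c • v) ((-c) • v)
        rw [N_hom (-c) (by linarith), ← add_smul, add_neg_cancel, zero_smul, N_zero] at h
        linarith
      · simp [N_zero]
      · rw [N_hom c hc])
  refine ⟨L, ?_, hLN⟩
  have hv : v ∈ (LinearPMap.mkSpanSingleton' v (N v) H).domain :=
    Submodule.mem_span_singleton_self v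
  simpa only [LinearPMap.mkSpanSingleton'_apply_self] using hL ⟨v, hv⟩

section Duality

variable {E : Type*} [NormedAddCommGroup E]

/-- A continuous cutoff equal to `1` on the ball of radius `n` and vanishing outside the ball of
radius `n + 1`. -/
def ballCutoff (E : Type*) [NormedAddCommGroup E] (n : ℕ) : E →ᵇ ℝ :=
  BoundedContinuousFunction.ofNormedAddCommGroup (fun x => max 0 (min 1 ((n : ℝ) + 1 - ‖x‖)))
    (by fun_prop) 1 (fun x => by
      rw [Real.norm_of_nonneg (le_max_left _ _)]
      exact max_le zero_le_one (min_le_left _ _))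

theorem ballCutoff_apply (n : ℕ) (x : E) :
    ballCutoff E n x = max 0 (min 1 ((n : ℝ) + 1 - ‖x‖)) := rfl

theorem ballCutoff_nonneg (n : ℕ) (x : E) : 0 ≤ ballCutoff E n x := le_max_left _ _

theorem ballCutoff_le_one (n : ℕ) (x : E) : ballCutoff E n x ≤ 1 :=
  max_le zero_le_one (min_le_left _ _)

theorem ballCutoff_eq_zero {n : ℕ} {x : E} (hx : x ∉ Metric.closedBall (0 : E) (n + 1)) :
    ballCutoff E n x = 0 := by
  rw [mem_closedBall_zero_iff, not_le] at hx
  rw [ballCutoff_apply]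
  exact max_eq_left ((min_le_right _ _).trans (by linarith))

theorem tendsto_ballCutoff (x : E) : Tendsto (fun n => ballCutoff E n x) atTop (𝓝 1) := by
  obtain ⟨N, hN⟩ := exists_nat_ge ‖x‖
  refine tendsto_const_nhds.congr' ?_
  filter_upwards [eventually_ge_atTop N] with n hn
  have hn' : (N : ℝ) ≤ n := by exact_mod_cast hn
  rw [ballCutoff_apply, min_eq_left (by linarith), max_eq_right zero_le_one]

/-- The pullback of a bounded continuous function along the first projection. -/
def pullFst (u : E →ᵇ ℝ) : E × E →ᵇ ℝ := u.compContinuous ⟨Prod.fst, continuous_fst⟩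

/-- The pullback of a bounded continuous function along the second projection. -/
def pullSnd (u : E →ᵇ ℝ) : E × E →ᵇ ℝ := u.compContinuous ⟨Prod.snd, continuous_snd⟩

@[simp]
theorem pullFst_apply (u : E →ᵇ ℝ) (p : E × E) : pullFst u p = u p.1 := rfl

@[simp]
theorem pullSnd_apply (u : E →ᵇ ℝ) (p : E × E) : pullSnd u p = u p.2 := rfl

/-- The product cutoff on `E × E`. -/
def prodCutoff (E : Type*) [NormedAddCommGroup E] (n : ℕ) : E × E →ᵇ ℝ :=
  pullFst (ballCutoff E n) * pullSnd (ballCutoff E n)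

theorem prodCutoff_apply (n : ℕ) (p : E × E) :
    prodCutoff E n p = ballCutoff E n p.1 * ballCutoff E n p.2 := rfl

theorem prodCutoff_nonneg (n : ℕ) (p : E × E) : 0 ≤ prodCutoff E n p :=
  mul_nonneg (ballCutoff_nonneg _ _) (ballCutoff_nonneg _ _)

theorem prodCutoff_le_one (n : ℕ) (p : E × E) : prodCutoff E n p ≤ 1 :=
  mul_le_one₀ (ballCutoff_le_one _ _) (ballCutoff_nonneg _ _) (ballCutoff_le_one _ _)

theorem tendsto_prodCutoff (p : E × E) : Tendsto (fun n => prodCutoff E n p) atTop (𝓝 1) := by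
  simpa only [mul_one, prodCutoff_apply] using
    (tendsto_ballCutoff p.1).mul (tendsto_ballCutoff p.2)

theorem one_sub_prodCutoff_le (n : ℕ) (p : E × E) :
    1 - prodCutoff E n p ≤ (1 - ballCutoff E n p.1) + (1 - ballCutoff E n p.2) := by
  rw [prodCutoff_apply]
  nlinarith [mul_nonneg (sub_nonneg.mpr (ballCutoff_le_one n p.1))
    (sub_nonneg.mpr (ballCutoff_le_one n p.2))]

theorem hasCompactSupport_mul_prodCutoff [ProperSpace E] (f : E × E →ᵇ ℝ) (n : ℕ) :
    HasCompactSupport (f * prodCutoff E n : E × E →ᵇ ℝ) := by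
  refine HasCompactSupport.intro
    ((isCompact_closedBall (0 : E) (n + 1)).prod (isCompact_closedBall (0 : E) (n + 1))) ?_
  intro p hp
  rw [Set.mem_prod, not_and_or] at hp
  rw [BoundedContinuousFunction.mul_apply, prodCutoff_apply]
  rcases hp with h | h <;> simp [ballCutoff_eq_zero h]

variable [MeasurableSpace E]

/-- The set of values of the dual problem of optimal transport with payoff `f`. -/
def dualValues (μ ν : Measure E) (f : E × E → ℝ) : Set ℝ :=
  {r | ∃ u v : E →ᵇ ℝ, (∀ x y, f (x, y) ≤ u x + v y) ∧ r = ∫ x, u x ∂μ + ∫ x, v x ∂ν}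

theorem dualValues_nonempty {μ ν : Measure E} (f : E × E →ᵇ ℝ) : (dualValues μ ν f).Nonempty :=
  ⟨_, BoundedContinuousFunction.const E ‖f‖, 0,
    fun x y => by simpa using (abs_le.mp (f.norm_coe_le_norm (x, y))).2, rfl⟩

theorem smul_mem_dualValues {μ ν : Measure E} {f : E × E →ᵇ ℝ} {r c : ℝ}
    (hc : 0 ≤ c) (hr : r ∈ dualValues μ ν f) : c * r ∈ dualValues μ ν (c • f : E × E →ᵇ ℝ) := by
  obtain ⟨u, v, huv, rfl⟩ := hr
  refine ⟨c • u, c • v, fun x y => ?_, ?_⟩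
  · simpa [mul_add] using mul_le_mul_of_nonneg_left (huv x y) hc
  · simp [integral_const_mul, mul_add]

variable [BorelSpace E]

theorem tendsto_integral_ballCutoff [ProperSpace E] (μ : Measure E) [IsProbabilityMeasure μ] :
    Tendsto (fun n => ∫ x, ballCutoff E n x ∂μ) atTop (𝓝 1) := by
  have h := tendsto_integral_of_dominated_convergence (μ := μ)
    (F := fun n x => ballCutoff E n x) (f := fun _ => (1 : ℝ)) (fun _ => 1)
    (fun n => (ballCutoff E n).continuous.aestronglyMeasurable) (integrable_const _)
    (fun n => Eventually.of_forall fun x => by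
      rw [Real.norm_of_nonneg (ballCutoff_nonneg n x)]
      exact ballCutoff_le_one n x)
    (Eventually.of_forall tendsto_ballCutoff)
  simpa using h

/-- A positive linear functional on `C_b(E × E)` whose marginals are given by probability measures
is the integral against a coupling of these measures. -/
theorem exists_coupling_of_positive [ProperSpace E] (μ ν : Measure E) [IsProbabilityMeasure μ]
    [IsProbabilityMeasure ν] (L : (E × E →ᵇ ℝ) →ₗ[ℝ] ℝ)
    (L_nonneg : ∀ f : E × E →ᵇ ℝ, (∀ p, 0 ≤ f p) → 0 ≤ L f)
    (L_fst : ∀ u : E →ᵇ ℝ, L (pullFst u) = ∫ x, u x ∂μ)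
    (L_snd : ∀ u : E →ᵇ ℝ, L (pullSnd u) = ∫ x, u x ∂ν) :
    ∃ P : Measure (E × E), IsProbabilityMeasure P ∧ P.map Prod.fst = μ ∧ P.map Prod.snd = ν ∧
      ∀ f : E × E →ᵇ ℝ, L f = ∫ p, f p ∂P := by
  have L_mono : ∀ f g : E × E →ᵇ ℝ, (∀ p, f p ≤ g p) → L f ≤ L g := by
    intro f g hfg
    have h := L_nonneg (g - f) fun p => by simpa using hfg p
    rw [map_sub] at h
    linarith
  have L_one : L 1 = 1 := by
    have h : (1 : E × E →ᵇ ℝ) = pullFst 1 := rfl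
    rw [h, L_fst]
    simp
  let Λ : C_c(E × E, ℝ) →ₚ[ℝ] ℝ := PositiveLinearMap.mk₀
    { toFun := fun g => L g.toBoundedContinuousFunction
      map_add' := fun g h => by rw [← map_add]; rfl
      map_smul' := fun r g => by rw [RingHom.id_apply, ← map_smul]; rfl }
    (fun g hg => L_nonneg _ fun p => hg p)
  let P : Measure (E × E) := RealRMK.rieszMeasure Λ
  have integral_cutoff (f : E × E →ᵇ ℝ) (n : ℕ) :
      ∫ p, f p * prodCutoff E n p ∂P = L (f * prodCutoff E n) :=
    RealRMK.integral_rieszMeasure Λ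
      ⟨(f * prodCutoff E n).toContinuousMap, hasCompactSupport_mul_prodCutoff f n⟩
  have integrable_cutoff (n : ℕ) : Integrable (prodCutoff E n) P := by
    refine (prodCutoff E n).continuous.integrable_of_hasCompactSupport ?_
    simpa using hasCompactSupport_mul_prodCutoff (E := E) 1 n
  have P_univ_le : P Set.univ ≤ 1 := by
    calc P Set.univ = ∫⁻ p, liminf (fun n => ENNReal.ofReal (prodCutoff E n p)) atTop ∂P := by
          rw [← lintegral_one]
          refine lintegral_congr fun p => ?_
          have h := (ENNReal.continuous_ofReal.tendsto 1).comp (tendsto_prodCutoff p)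
          simpa [Function.comp_def] using h.liminf_eq.symm
      _ ≤ liminf (fun n => ∫⁻ p, ENNReal.ofReal (prodCutoff E n p) ∂P) atTop :=
          lintegral_liminf_le fun n => (prodCutoff E n).continuous.measurable.ennreal_ofReal
      _ ≤ liminf (fun _ : ℕ => (1 : ENNReal)) atTop := by
          refine liminf_le_liminf (Eventually.of_forall fun n => ?_)
          rw [← ofReal_integral_eq_lintegral_ofReal (integrable_cutoff n)
            (Eventually.of_forall (prodCutoff_nonneg n)), ENNReal.ofReal_le_one]
          have h := integral_cutoff 1 n
          simp only [BoundedContinuousFunction.coe_one, Pi.one_apply, one_mul] at h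
          rw [h, ← L_one]
          exact L_mono _ _ (prodCutoff_le_one n)
      _ = 1 := by simp
  have : IsFiniteMeasure P := ⟨P_univ_le.trans_lt ENNReal.one_lt_top⟩
  have L_eq (f : E × E →ᵇ ℝ) : L f = ∫ p, f p ∂P := by
    have tendsto_integral : Tendsto (fun n => L (f * prodCutoff E n)) atTop
        (𝓝 (∫ p, f p ∂P)) := by
      simp_rw [← integral_cutoff]
      refine tendsto_integral_of_dominated_convergence (fun _ => ‖f‖)
        (fun n => (f * prodCutoff E n).continuous.aestronglyMeasurable) (integrable_const _)
        (fun n => Eventually.of_forall fun p => ?_) (Eventually.of_forall fun p => ?_)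
      · rw [norm_mul, Real.norm_of_nonneg (prodCutoff_nonneg n p)]
        exact (mul_le_of_le_one_right (norm_nonneg _) (prodCutoff_le_one n p)).trans
          (f.norm_coe_le_norm p)
      · simpa using (tendsto_prodCutoff p).const_mul (f p)
    have bound (n : ℕ) : |L (f * prodCutoff E n) - L f| ≤
        ‖f‖ * ((1 - ∫ x, ballCutoff E n x ∂μ) + (1 - ∫ x, ballCutoff E n x ∂ν)) := by
      let w : E × E →ᵇ ℝ :=
        ‖f‖ • ((1 - pullFst (ballCutoff E n)) + (1 - pullSnd (ballCutoff E n)))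
      have hw : L w =
          ‖f‖ * ((1 - ∫ x, ballCutoff E n x ∂μ) + (1 - ∫ x, ballCutoff E n x ∂ν)) := by
        simp only [w, map_smul, map_add, map_sub, L_one, L_fst, L_snd, smul_eq_mul]
      have abs_le_w (p : E × E) : |f p * prodCutoff E n p - f p| ≤ w p := by
        have h : f p * prodCutoff E n p - f p = -(f p * (1 - prodCutoff E n p)) := by ring
        rw [h, abs_neg, abs_mul, abs_of_nonneg (sub_nonneg.mpr (prodCutoff_le_one n p))]
        exact mul_le_mul (f.norm_coe_le_norm p) (one_sub_prodCutoff_le n p)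
          (sub_nonneg.mpr (prodCutoff_le_one n p)) (norm_nonneg _)
      rw [← hw, ← map_sub, abs_le, ← map_neg]
      exact ⟨L_mono _ _ fun p => (abs_le.mp (abs_le_w p)).1,
        L_mono _ _ fun p => (abs_le.mp (abs_le_w p)).2⟩
    have tendsto_L : Tendsto (fun n => L (f * prodCutoff E n)) atTop (𝓝 (L f)) := by
      rw [tendsto_iff_dist_tendsto_zero]
      refine squeeze_zero (fun _ => dist_nonneg) bound ?_
      simpa using (((tendsto_integral_ballCutoff μ).const_sub 1).add
        ((tendsto_integral_ballCutoff ν).const_sub 1)).const_mul ‖f‖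
    exact tendsto_nhds_unique tendsto_L tendsto_integral
  have map_fst : P.map Prod.fst = μ := by
    refine ext_of_forall_integral_eq_of_IsFiniteMeasure fun u => ?_
    rw [integral_map measurable_fst.aemeasurable u.continuous.aestronglyMeasurable, ← L_fst, L_eq]
    rfl
  have map_snd : P.map Prod.snd = ν := by
    refine ext_of_forall_integral_eq_of_IsFiniteMeasure fun u => ?_
    rw [integral_map measurable_snd.aemeasurable u.continuous.aestronglyMeasurable, ← L_snd, L_eq]
    rfl
  refine ⟨P, ⟨?_⟩, map_fst, map_snd, L_eq⟩
  rw [← Set.preimage_univ (f := Prod.fst), ← Measure.map_apply measurable_fst .univ, map_fst,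
    measure_univ]

/-- Weak duality. -/
theorem integral_le_of_mem_dualValues [ProperSpace E] {μ ν : Measure E}
    {P : Measure (E × E)} [IsProbabilityMeasure P] (hfst : P.map Prod.fst = μ) (hsnd : P.map Prod.snd = ν)
    (f : E × E →ᵇ ℝ) {r : ℝ} (hr : r ∈ dualValues μ ν f) : ∫ p, f p ∂P ≤ r := by
  obtain ⟨u, v, huv, rfl⟩ := hr
  rw [← hfst, ← hsnd,
    integral_map measurable_fst.aemeasurable u.continuous.aestronglyMeasurable,
    integral_map measurable_snd.aemeasurable v.continuous.aestronglyMeasurable,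
    ← integral_add (f := fun p : E × E => u p.1) (g := fun p : E × E => v p.2)
      ((pullFst u).integrable P) ((pullSnd v).integrable P)]
  exact integral_mono (f.integrable P) (((pullFst u).integrable P).add ((pullSnd v).integrable P))
    fun p => huv p.1 p.2

variable {μ ν : Measure E} [IsProbabilityMeasure μ] [IsProbabilityMeasure ν]

theorem le_of_mem_dualValues {a r : ℝ} {f : E × E → ℝ} (hf : ∀ p, a ≤ f p)
    (hr : r ∈ dualValues μ ν f) : a ≤ r := by
  obtain ⟨u, v, huv, rfl⟩ := hr
  have hv (y : E) : a - ∫ x, u x ∂μ ≤ v y := by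
    have h : ∫ _, (a - v y) ∂μ ≤ ∫ x, u x ∂μ :=
      integral_mono (integrable_const _) (u.integrable μ) fun x => by
        linarith [hf (x, y), huv x y]
    simp only [integral_const, probReal_univ, one_smul] at h
    linarith
  have h : ∫ _, (a - ∫ x, u x ∂μ) ∂ν ≤ ∫ y, v y ∂ν :=
    integral_mono (integrable_const _) (v.integrable ν) hv
  simp only [integral_const, probReal_univ, one_smul] at h
  linarith

theorem bddBelow_dualValues (f : E × E →ᵇ ℝ) : BddBelow (dualValues μ ν f) :=
  ⟨-‖f‖, fun _ hr => le_of_mem_dualValues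
    (fun p => (abs_le.mp (f.norm_coe_le_norm p)).1) hr⟩

theorem add_mem_dualValues {f g : E × E →ᵇ ℝ} {r s : ℝ} (hr : r ∈ dualValues μ ν f)
    (hs : s ∈ dualValues μ ν g) : r + s ∈ dualValues μ ν (f + g : E × E →ᵇ ℝ) := by
  obtain ⟨u, v, huv, rfl⟩ := hr
  obtain ⟨u', v', huv', rfl⟩ := hs
  refine ⟨u + u', v + v', fun x y => ?_, ?_⟩
  · simp only [BoundedContinuousFunction.add_apply]
    linarith [huv x y, huv' x y]
  · simp only [BoundedContinuousFunction.add_apply]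
    rw [integral_add (u.integrable μ) (u'.integrable μ),
      integral_add (v.integrable ν) (v'.integrable ν)]
    ring

theorem sInf_dualValues_smul {c : ℝ} (hc : 0 < c) (f : E × E →ᵇ ℝ) :
    sInf (dualValues μ ν (c • f : E × E →ᵇ ℝ)) = c * sInf (dualValues μ ν f) := by
  have key : ∀ (c : ℝ), 0 < c → ∀ f : E × E →ᵇ ℝ,
      sInf (dualValues μ ν (c • f : E × E →ᵇ ℝ)) ≤ c * sInf (dualValues μ ν f) := by
    intro c hc f
    rw [← div_le_iff₀' hc]
    refine le_csInf (dualValues_nonempty f) fun r hr => ?_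
    rw [div_le_iff₀' hc]
    exact csInf_le (bddBelow_dualValues _) (smul_mem_dualValues hc.le hr)
  refine le_antisymm (key c hc f) ?_
  have h := key c⁻¹ (inv_pos.mpr hc) (c • f)
  rwa [inv_smul_smul₀ hc.ne', le_inv_mul_iff₀ hc] at h

theorem sInf_dualValues_add_le (f g : E × E →ᵇ ℝ) :
    sInf (dualValues μ ν (f + g : E × E →ᵇ ℝ)) ≤
      sInf (dualValues μ ν f) + sInf (dualValues μ ν g) := by
  rw [← sub_le_iff_le_add]
  refine le_csInf (dualValues_nonempty f) fun r hr => ?_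
  rw [sub_le_comm]
  refine le_csInf (dualValues_nonempty g) fun s hs => ?_
  rw [sub_le_iff_le_add']
  exact csInf_le (bddBelow_dualValues _) (add_mem_dualValues hr hs)

variable (μ ν) in
/-- The infimum of the dual problem is attained as the payoff of some coupling. -/
theorem exists_coupling_integral_eq_sInf_dualValues [ProperSpace E] (f : E × E →ᵇ ℝ) :
    ∃ P : Measure (E × E), IsProbabilityMeasure P ∧ P.map Prod.fst = μ ∧ P.map Prod.snd = ν ∧
      ∫ p, f p ∂P = sInf (dualValues μ ν f) := by
  obtain ⟨L, hLf, hL⟩ := exists_linearMap_le_sublinear_eq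
    (fun g : E × E →ᵇ ℝ => sInf (dualValues μ ν g))
    (fun c hc g => by exact sInf_dualValues_smul hc g)
    (fun g h => by exact sInf_dualValues_add_le g h) f
  have L_le {g : E × E →ᵇ ℝ} {r : ℝ} (hr : r ∈ dualValues μ ν g) : L g ≤ r :=
    (hL g).trans (csInf_le (bddBelow_dualValues g) hr)
  have L_fst_le (u : E →ᵇ ℝ) : L (pullFst u) ≤ ∫ x, u x ∂μ :=
    L_le (r := ∫ x, u x ∂μ) ⟨u, 0, fun x y => by simp, by simp⟩
  have L_snd_le (u : E →ᵇ ℝ) : L (pullSnd u) ≤ ∫ x, u x ∂ν :=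
    L_le ⟨0, u, fun x y => by simp, by simp⟩
  obtain ⟨P, hP, hfst, hsnd, hLP⟩ := exists_coupling_of_positive μ ν L
    (fun g hg => by
      have h : L (-g) ≤ 0 := L_le ⟨0, 0, fun x y => by simpa using hg (x, y), by simp⟩
      rw [map_neg] at h
      linarith)
    (fun u => by
      refine le_antisymm (L_fst_le u) ?_
      have h : -L (pullFst u) ≤ ∫ x, -u x ∂μ := by
        rw [← map_neg]
        exact L_fst_le (-u)
      rw [integral_neg] at h
      linarith)
    (fun u => by
      refine le_antisymm (L_snd_le u) ?_
      have h : -L (pullSnd u) ≤ ∫ x, -u x ∂ν := by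
        rw [← map_neg]
        exact L_snd_le (-u)
      rw [integral_neg] at h
      linarith)
  exact ⟨P, hP, hfst, hsnd, by rw [← hLP, hLf]⟩

end Duality

/-- Kantorovich duality for a bounded continuous cost: the supremum of `∫ c dP` over all
couplings of `(μ1, μ2)` equals the infimum of `∫ u1 dμ1 + ∫ u2 dμ2` over bounded continuous
`u1, u2` with `u1(s1) + u2(s2) ≥ c(s1, s2)` everywhere. -/
theorem kantorovich_duality {d : ℕ} (μ1 μ2 : Measure (EuclideanSpace ℝ (Fin d)))
    [IsProbabilityMeasure μ1] [IsProbabilityMeasure μ2]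
    (c : EuclideanSpace ℝ (Fin d) × EuclideanSpace ℝ (Fin d) → ℝ)
    (hc : Continuous c) (hcb : ∃ M : ℝ, ∀ p, |c p| ≤ M) :
    sSup {r : ℝ | ∃ P : Measure (EuclideanSpace ℝ (Fin d) × EuclideanSpace ℝ (Fin d)),
        IsProbabilityMeasure P ∧ IsCoupling μ1 μ2 P ∧ r = ∫ p, c p ∂P} =
      sInf {r : ℝ | ∃ u1 u2 : EuclideanSpace ℝ (Fin d) →ᵇ ℝ,
        (∀ s1 s2 : EuclideanSpace ℝ (Fin d), c (s1, s2) ≤ u1 s1 + u2 s2) ∧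
        r = ∫ x, u1 x ∂μ1 + ∫ x, u2 x ∂μ2} := by
  obtain ⟨M, hM⟩ := hcb
  let f : EuclideanSpace ℝ (Fin d) × EuclideanSpace ℝ (Fin d) →ᵇ ℝ :=
    BoundedContinuousFunction.ofNormedAddCommGroup c hc M hM
  obtain ⟨P, hP, hfst, hsnd, hPf⟩ := exists_coupling_integral_eq_sInf_dualValues μ1 μ2 f
  refine IsGreatest.csSup_eq ⟨⟨P, hP, ⟨hfst, hsnd⟩, hPf.symm⟩, ?_⟩
  rintro _ ⟨Q, hQ, ⟨hQ1, hQ2⟩, rfl⟩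
  exact le_csInf (dualValues_nonempty f) fun r hr => integral_le_of_mem_dualValues hQ1 hQ2 f hr
end
end

section
/- Brenier-type theorem under the twist condition: let μ1, μ2 be Borel probability measures on ℝ^d with μ1 absolutely continuous with respect to Lebesgue measure, and let c : ℝ^d × ℝ^d → ℝ be bounded continuous, differentiable in its first variable, and satisfying the twist condition: for every s1 ∈ ℝ^d, the map s2 ↦ ∇_{s1} c(s1, s2) is injective on ℝ^d. Then there is a unique coupling P* of (μ1, μ2) maximizing ∫ c dP over all couplings, and P* is supported on the graph of a Borel map T : ℝ^d → ℝ^d, i.e. P* is the pushforward of μ1 by s1 ↦ (s1, T(s1)); in particular T pushes μ1 forward to μ2. -/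
open MeasureTheory

noncomputable section

section Subgradients

open Filter Topology Metric Set Pointwise

variable {E : Type*} [NormedAddCommGroup E] [NormedSpace ℝ E]

/-- `p` is a Fréchet subgradient at `x` of the restriction of `φ` to `A`. -/
def IsSubgradientWithinAt (φ : E → ℝ) (p : E →L[ℝ] ℝ) (A : Set E) (x : E) : Prop :=
  ∀ ε > 0, ∀ᶠ y in 𝓝[A] x, φ x + p (y - x) - ε * ‖y - x‖ ≤ φ y

variable [MeasurableSpace E] [BorelSpace E] [FiniteDimensional ℝ E]

/-- A linear form which is at most `o(‖y - x‖)` along a set of Lebesgue density one at `x`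
vanishes. -/
lemma ContinuousLinearMap.eq_zero_of_le_of_density_one (μ : Measure E) [μ.IsAddHaarMeasure]
    {S : Set E} {x : E}
    (hx : Tendsto (fun r => μ (S ∩ closedBall x r) / μ (closedBall x r)) (𝓝[>] 0) (𝓝 1))
    (l : E →L[ℝ] ℝ) (hl : ∀ ε > 0, ∀ᶠ y in 𝓝[S] x, l (y - x) ≤ ε * ‖y - x‖) : l = 0 := by
  have key : ∀ z, l z ≤ 0 := by
    intro z
    by_contra! hz
    set η := l z / (2 * (‖z‖ + 1)) with hη
    have hηpos : 0 < η := by positivity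
    have hzη : η * ‖z‖ < l z := by
      rw [hη, div_mul_eq_mul_div, div_lt_iff₀ (by positivity)]
      nlinarith [norm_nonneg z]
    have hopen : {a : E | η * ‖a‖ < l a} ∈ 𝓝 z :=
      (isOpen_lt (by fun_prop) (by fun_prop)).mem_nhds hzη
    obtain ⟨δ, hδ, hball⟩ := nhds_basis_closedBall.mem_iff.1 hopen
    obtain ⟨ρ, hρ, hS⟩ := mem_nhdsWithin_iff.1 (hl η hηpos)
    have h₁ : ∀ᶠ r in 𝓝[>] (0 : ℝ), (S ∩ ({x} + r • closedBall z δ)).Nonempty :=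
      Measure.eventually_nonempty_inter_smul_of_density_one μ S x hx _ measurableSet_closedBall
        (measure_closedBall_pos μ z hδ).ne'
    have h₂ : ∀ᶠ r in 𝓝[>] (0 : ℝ), {x} + r • closedBall z δ ⊆ ball x ρ :=
      nhdsWithin_le_nhds
        (eventually_singleton_add_smul_subset isBounded_closedBall (ball_mem_nhds x hρ))
    obtain ⟨r, ⟨y, hyS, hy⟩, hrρ, hr⟩ := (h₁.and (h₂.and self_mem_nhdsWithin)).exists
    have hyl := hS ⟨hrρ hy, hyS⟩
    obtain ⟨a, ha, rfl⟩ : ∃ a ∈ closedBall z δ, x + r • a = y := by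
      obtain ⟨_, rfl, _, ⟨a, ha, rfl⟩, rfl⟩ := hy
      exact ⟨a, ha, rfl⟩
    have hr' : 0 < r := hr
    have hla : η * ‖a‖ < l a := hball ha
    simp only [mem_ofPred_eq, add_sub_cancel_left, map_smul, smul_eq_mul, norm_smul,
      Real.norm_eq_abs, abs_of_pos hr'] at hyl
    nlinarith
  ext z
  have := key (-z)
  simp only [map_neg] at this
  simpa using le_antisymm (key z) (by linarith)

/-- An arbitrary real function on a subset of a finite-dimensional space has almost everywhere at
most one Fréchet subgradient. -/
lemma ae_isSubgradientWithinAt_unique (μ : Measure E) [μ.IsAddHaarMeasure] (φ : E → ℝ)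
    (A : Set E) :
    ∀ᵐ x ∂μ, x ∈ A → ∀ p q, IsSubgradientWithinAt φ p A x → IsSubgradientWithinAt φ q A x →
      p = q := by
  let B : ℕ → Set E := fun n =>
    {x ∈ A | ∀ y ∈ A, dist y x < 1 / (n + 1 : ℝ) → φ x - φ y ≤ n * dist y x}
  let t : ℕ → ℕ → Set E := fun n k =>
    B n ∩ ball (TopologicalSpace.denseSeq E k) (1 / (n + 1 : ℝ) / 2)
  have hlip : ∀ n k : ℕ, LipschitzOnWith n φ (t n k) := by
    intro n k
    refine LipschitzOnWith.of_le_add_mul _ fun x hx y hy => ?_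
    have hxy : dist y x < 1 / (n + 1 : ℝ) :=
      (dist_triangle_right y x (TopologicalSpace.denseSeq E k)).trans_lt
        (by linarith [mem_ball.1 hx.2, mem_ball.1 hy.2])
    have := hx.1.2 y hy.1.1 hxy
    rw [dist_comm] at this
    simp only [NNReal.coe_natCast]
    linarith
  have hae : ∀ᵐ x ∂μ, ∀ n k, x ∈ t n k →
      DifferentiableWithinAt ℝ φ (t n k) x ∧
      Tendsto (fun r => μ (t n k ∩ closedBall x r) / μ (closedBall x r)) (𝓝[>] 0) (𝓝 1) := by
    refine ae_all_iff.2 fun n => ae_all_iff.2 fun k => ?_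
    filter_upwards [(hlip n k).ae_differentiableWithinAt_of_mem (μ := μ),
      ae_imp_of_ae_restrict (Besicovitch.ae_tendsto_measure_inter_div μ (t n k))] with x h₁ h₂ hx
    exact ⟨h₁ hx, h₂ hx⟩
  filter_upwards [hae] with x hx hxA p q hp hq
  obtain ⟨n, hn⟩ : ∃ n, x ∈ B n := by
    obtain ⟨ρ, hρ, hsub⟩ := mem_nhdsWithin_iff.1 (hp 1 one_pos)
    obtain ⟨n, hn₁, hn₂⟩ : ∃ n : ℕ, 1 / (n + 1 : ℝ) < ρ ∧ ‖p‖ + 1 ≤ n :=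
      ((tendsto_one_div_add_atTop_nhds_zero_nat.eventually (gt_mem_nhds hρ)).and
        (tendsto_natCast_atTop_atTop.eventually (eventually_ge_atTop (‖p‖ + 1)))).exists
    refine ⟨n, hxA, fun y hy hyx => ?_⟩
    have h₁ : φ x + p (y - x) - 1 * ‖y - x‖ ≤ φ y := hsub ⟨mem_ball.2 (hyx.trans hn₁), hy⟩
    have h₂ := neg_le_of_abs_le ((Real.norm_eq_abs _).symm.le.trans (p.le_opNorm (y - x)))
    rw [dist_eq_norm]
    nlinarith [norm_nonneg (y - x)]
  obtain ⟨k, hk⟩ : ∃ k, x ∈ t n k := by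
    obtain ⟨k, hk⟩ := (TopologicalSpace.denseRange_denseSeq E).exists_dist_lt x
      (show 0 < 1 / (n + 1 : ℝ) / 2 by positivity)
    exact ⟨k, hn, mem_ball.2 hk⟩
  obtain ⟨hd, hdens⟩ := hx n k hk
  have huniq : ∀ p, IsSubgradientWithinAt φ p A x → p = fderivWithin ℝ φ (t n k) x := by
    intro p hp
    rw [← sub_eq_zero]
    refine ContinuousLinearMap.eq_zero_of_le_of_density_one μ hdens _ fun ε hε => ?_
    have hsub : t n k ⊆ A := fun y hy => hy.1.1
    filter_upwards [nhdsWithin_mono x hsub (hp (ε / 2) (half_pos hε)),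
      hd.hasFDerivWithinAt.isLittleO.def (half_pos hε)] with y h₁ h₂
    rw [Real.norm_eq_abs] at h₂
    have := le_of_abs_le h₂
    simp only [sub_apply]
    linarith
  rw [huniq p hp, huniq q hq]

end Subgradients

section CyclicMonotonicity

variable {X Y : Type*}

/-- A set `Γ` is `c`-cyclically monotone (for maximization) if no permutation of the first
coordinates of finitely many points of `Γ` increases the total value of `c`. -/
def IsCyclicallyMonotone (c : X × Y → ℝ) (Γ : Set (X × Y)) : Prop :=
  ∀ (n : ℕ) (z : Fin n → X × Y) (σ : Equiv.Perm (Fin n)), (∀ i, z i ∈ Γ) →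
    ∑ i, c ((z (σ i)).1, (z i).2) ≤ ∑ i, c (z i)

/-- The values at `x` of the chains of points of `Γ` starting at `z₀`. -/
def chainValues (c : X × Y → ℝ) (Γ : Set (X × Y)) (z₀ : X × Y) (x : X) : Set ℝ :=
  {v | ∃ (n : ℕ) (f : ℕ → X × Y), (∀ i, f i ∈ Γ) ∧ f 0 = z₀ ∧
    v = ∑ i ∈ Finset.range n, (c ((f (i + 1)).1, (f i).2) - c (f i)) +
      (c (x, (f n).2) - c (f n))}

lemma add_mem_chainValues {c : X × Y → ℝ} {Γ : Set (X × Y)} {z₀ : X × Y} {x : X} {y : Y}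
    {v : ℝ} (hxy : (x, y) ∈ Γ) (hv : v ∈ chainValues c Γ z₀ x) (x' : X) :
    v + (c (x', y) - c (x, y)) ∈ chainValues c Γ z₀ x' := by
  obtain ⟨n, f, hf, hf0, rfl⟩ := hv
  refine ⟨n + 1, fun i => if i ≤ n then f i else (x, y), fun i => ?_, by simpa using hf0, ?_⟩
  · dsimp only
    split_ifs
    exacts [hf i, hxy]
  · rw [Finset.sum_range_succ]
    have : ∀ i ∈ Finset.range n,
        c (((fun i => if i ≤ n then f i else (x, y)) (i + 1)).1,
          ((fun i => if i ≤ n then f i else (x, y)) i).2) -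
          c ((fun i => if i ≤ n then f i else (x, y)) i) =
        c ((f (i + 1)).1, (f i).2) - c (f i) := by
      intro i hi
      have hi' := Finset.mem_range.1 hi
      simp [hi'.le, Nat.succ_le_of_lt hi']
    rw [Finset.sum_congr rfl this]
    simp

lemma IsCyclicallyMonotone.chainValues_nonpos {c : X × Y → ℝ} {Γ : Set (X × Y)}
    (h : IsCyclicallyMonotone c Γ) {z₀ : X × Y} {v : ℝ}
    (hv : v ∈ chainValues c Γ z₀ z₀.1) : v ≤ 0 := by
  obtain ⟨n, f, hf, hf0, rfl⟩ := hv
  have := h (n + 1) (fun i => f i) (finRotate (n + 1)) (fun i => hf i)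
  rw [Fin.sum_univ_castSucc, Fin.sum_univ_castSucc] at this
  simp only [finRotate_last, Fin.val_zero, Fin.val_castSucc, Fin.val_last, hf0,
    Fin.sum_univ_eq_sum_range (fun i => c (f i)) n] at this
  have h' : ∀ i : Fin n, ((finRotate (n + 1)) i.castSucc : ℕ) = i + 1 := by
    intro i
    rw [coe_finRotate_of_ne_last (Fin.castSucc_lt_last i).ne]
    simp
  simp only [h', Fin.sum_univ_eq_sum_range (fun i => c ((f (i + 1)).1, (f i).2)) n] at this
  rw [Finset.sum_sub_distrib]
  linarith

/-- A `c`-cyclically monotone set admits a potential. -/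
lemma IsCyclicallyMonotone.exists_potential {c : X × Y → ℝ} {Γ : Set (X × Y)}
    (h : IsCyclicallyMonotone c Γ) :
    ∃ φ : X → ℝ, ∀ x y, (x, y) ∈ Γ → ∀ x' ∈ Prod.fst '' Γ,
      φ x + (c (x', y) - c (x, y)) ≤ φ x' := by
  rcases Γ.eq_empty_or_nonempty with rfl | ⟨z₀, hz₀⟩
  · exact ⟨0, by simp⟩
  refine ⟨fun x => sSup (chainValues c Γ z₀ x), ?_⟩
  rintro x y hxy x' ⟨⟨x', y'⟩, hxy', rfl⟩
  have hbdd : BddAbove (chainValues c Γ z₀ x') := by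
    refine ⟨-(c (z₀.1, y') - c (x', y')), fun v hv => ?_⟩
    have := h.chainValues_nonpos (add_mem_chainValues hxy' hv z₀.1)
    linarith
  rw [← le_sub_iff_add_le]
  refine csSup_le ⟨_, 0, fun _ => z₀, fun _ => hz₀, rfl, rfl⟩ fun v hv => ?_
  rw [le_sub_iff_add_le]
  exact le_csSup hbdd (add_mem_chainValues hxy hv x')

end CyclicMonotonicity

section Optimality

open Filter Topology Metric Set
open scoped NNReal ENNReal

variable {X Y : Type*} [MeasurableSpace X] [MeasurableSpace Y]

lemma map_eq_map_of_add_smul_eq_add_smul {Z W : Type*} [MeasurableSpace Z] [MeasurableSpace W]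
    {P P' ρ τ : Measure Z} [IsFiniteMeasure ρ] {ε : ℝ≥0} (hadd : P' + ε • ρ = P + ε • τ)
    {f : Z → W} (hf : Measurable f) (hf_eq : τ.map f = ρ.map f) : P'.map f = P.map f := by
  have h := congrArg (Measure.map f) hadd
  rw [Measure.map_add _ _ hf, Measure.map_add _ _ hf, Measure.map_smul, Measure.map_smul,
    hf_eq] at h
  ext s hs
  have hs' := congrArg (fun ν : Measure W => ν s) h
  simp only [Measure.add_apply] at hs'
  exact (ENNReal.add_left_inj (measure_ne_top (ε • ρ.map f) s)).1 hs'

/-- If `P` maximizes `∫ c` among the measures with the same marginals, then replacing a part `ρ`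
of `P` by a measure `τ` with the same marginals as `ρ` does not increase `∫ c`. -/
lemma integral_le_of_le_smul_of_optimal {c : X × Y → ℝ} (hc : Measurable c) {M : ℝ}
    (hM : ∀ p, |c p| ≤ M) {P : Measure (X × Y)} [IsProbabilityMeasure P]
    (hP : ∀ P' : Measure (X × Y), IsProbabilityMeasure P' → P'.map Prod.fst = P.map Prod.fst →
      P'.map Prod.snd = P.map Prod.snd → ∫ p, c p ∂P' ≤ ∫ p, c p ∂P)
    {τ ρ : Measure (X × Y)} [IsFiniteMeasure τ] [IsFiniteMeasure ρ] {K : ℝ≥0} (hρ : ρ ≤ K • P)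
    (hfst : τ.map Prod.fst = ρ.map Prod.fst) (hsnd : τ.map Prod.snd = ρ.map Prod.snd) :
    ∫ p, c p ∂τ ≤ ∫ p, c p ∂ρ := by
  have h_integrable : ∀ (ν : Measure (X × Y)) [IsFiniteMeasure ν], Integrable c ν := fun ν _ =>
    Integrable.of_bound hc.aestronglyMeasurable M (ae_of_all _ hM)
  set ε : ℝ≥0 := (K + 1)⁻¹ with hε
  have hεpos : 0 < ε := by positivity
  have hερ : ε • ρ ≤ P := by
    calc ε • ρ ≤ ε • (K • P) := by gcongr
      _ = (ε * K) • P := smul_smul _ _ _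
      _ ≤ (1 : ℝ≥0) • P := by
        gcongr
        rw [hε, inv_mul_le_iff₀ (by positivity)]
        simp
      _ = P := one_smul _ _
  obtain ⟨P', hadd⟩ : ∃ P' : Measure (X × Y), P' + ε • ρ = P + ε • τ :=
    ⟨P - ε • ρ + ε • τ, by rw [add_right_comm, Measure.sub_add_cancel_of_le hερ]⟩
  have hP'₁ := map_eq_map_of_add_smul_eq_add_smul hadd measurable_fst hfst
  have hP'₂ := map_eq_map_of_add_smul_eq_add_smul hadd measurable_snd hsnd
  have hprob : IsProbabilityMeasure P' := by
    have : IsProbabilityMeasure (P'.map Prod.fst) := by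
      rw [hP'₁]
      exact Measure.isProbabilityMeasure_map measurable_fst.aemeasurable
    exact Measure.isProbabilityMeasure_of_map Prod.fst
  have hle := hP P' hprob hP'₁ hP'₂
  have heq := congrArg (fun ν : Measure (X × Y) => ∫ p, c p ∂ν) hadd
  simp only [integral_add_measure (h_integrable _) (h_integrable _), integral_smul_nnreal_measure,
    NNReal.smul_def, smul_eq_mul] at heq
  have hεpos' : 0 < (ε : ℝ) := hεpos
  nlinarith

variable [PseudoMetricSpace X] [PseudoMetricSpace Y] [SecondCountableTopology X]
  [SecondCountableTopology Y] [BorelSpace X] [BorelSpace Y]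

/-- The support of a maximizer of `∫ c` among the measures with the same marginals is
`c`-cyclically monotone. -/
lemma isCyclicallyMonotone_support_of_optimal {c : X × Y → ℝ} (hc : Continuous c) {M : ℝ}
    (hM : ∀ p, |c p| ≤ M) {P : Measure (X × Y)} [IsProbabilityMeasure P]
    (hP : ∀ P' : Measure (X × Y), IsProbabilityMeasure P' → P'.map Prod.fst = P.map Prod.fst →
      P'.map Prod.snd = P.map Prod.snd → ∫ p, c p ∂P' ≤ ∫ p, c p ∂P) :
    IsCyclicallyMonotone c P.support := by
  intro n z σ hz
  have h_integrable : ∀ (ν : Measure (X × Y)) [IsFiniteMeasure ν], Integrable c ν := fun ν _ =>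
    Integrable.of_bound hc.measurable.aestronglyMeasurable M (ae_of_all _ hM)
  suffices H : ∀ η > 0, ∑ i, c ((z (σ i)).1, (z i).2) ≤ ∑ i, c (z i) + η * (2 * n) by
    have hlim : Tendsto (fun η : ℝ => ∑ i, c (z i) + η * (2 * n)) (𝓝[>] 0)
        (𝓝 (∑ i, c (z i) + 0 * (2 * n))) :=
      Tendsto.mono_left (Continuous.tendsto (by fun_prop) 0) nhdsWithin_le_nhds
    rw [zero_mul, add_zero] at hlim
    exact ge_of_tendsto hlim (eventually_nhdsWithin_of_forall H)
  intro η hη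
  have hnear : ∀ a : X × Y, ∀ᶠ δ in 𝓝[>] (0 : ℝ), ∀ p ∈ ball a δ, |c p - c a| < η := by
    intro a
    obtain ⟨δ₀, hδ₀, h⟩ := Metric.continuousAt_iff.1 hc.continuousAt η hη
    filter_upwards [Ioo_mem_nhdsGT hδ₀] with δ hδ p hp
    exact h ((mem_ball.1 hp).trans hδ.2)
  obtain ⟨δ, ⟨hdiag, hperm⟩, hδ⟩ :=
    (((eventually_all.2 fun i => hnear (z i)).and
      (eventually_all.2 fun i => hnear ((z (σ i)).1, (z i).2))).and self_mem_nhdsWithin).exists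
  have hδ' : 0 < δ := hδ
  have hpos : ∀ i, P (ball (z i) δ) ≠ 0 := fun i =>
    ((Measure.mem_support_iff_forall _).1 (hz i) _ (ball_mem_nhds _ hδ')).ne'
  let R : Fin n → Measure (X × Y) := fun i => ProbabilityTheory.cond P (ball (z i) δ)
  have hRprob : ∀ i, IsProbabilityMeasure (R i) := fun i =>
    ProbabilityTheory.cond_isProbabilityMeasure (hpos i)
  have hRmem : ∀ i, ∀ᵐ p ∂(R i), p ∈ ball (z i) δ := fun i =>
    ProbabilityTheory.ae_cond_mem measurableSet_ball
  let Q : Fin n → Measure (X × Y) := fun i => (R (σ i)).fst.prod (R i).snd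
  have hQmem : ∀ i, ∀ᵐ p ∂(Q i), p ∈ ball ((z (σ i)).1, (z i).2) δ := by
    intro i
    have h₁ : ∀ᵐ x ∂(R (σ i)).fst, x ∈ ball (z (σ i)).1 δ := by
      refine (ae_map_iff measurable_fst.aemeasurable measurableSet_ball).2 ?_
      filter_upwards [hRmem (σ i)] with p hp
      exact (le_max_left _ _).trans_lt hp
    have h₂ : ∀ᵐ y ∂(R i).snd, y ∈ ball (z i).2 δ := by
      refine (ae_map_iff measurable_snd.aemeasurable measurableSet_ball).2 ?_
      filter_upwards [hRmem i] with p hp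
      exact (le_max_right _ _).trans_lt hp
    filter_upwards [Measure.quasiMeasurePreserving_fst.ae h₁,
      Measure.quasiMeasurePreserving_snd.ae h₂] with p hp₁ hp₂
    exact max_lt (mem_ball.1 hp₁) (mem_ball.1 hp₂)
  have hQR : ∫ p, c p ∂(∑ i, Q i) ≤ ∫ p, c p ∂(∑ i, R i) := by
    refine integral_le_of_le_smul_of_optimal (K := ∑ i, (P (ball (z i) δ))⁻¹.toNNReal)
      hc.measurable hM hP ?_ ?_ ?_
    · rw [Finset.sum_smul]
      refine Finset.sum_le_sum fun i _ => ?_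
      have : (P (ball (z i) δ))⁻¹.toNNReal • P = (P (ball (z i) δ))⁻¹ • P := by
        rw [ENNReal.smul_def, ENNReal.coe_toNNReal (ENNReal.inv_ne_top.2 (hpos i))]
      rw [this]
      change (P (ball (z i) δ))⁻¹ • P.restrict (ball (z i) δ) ≤ _
      gcongr
      exact Measure.restrict_le_self
    · rw [Measure.map_finset_sum measurable_fst.aemeasurable,
        Measure.map_finset_sum measurable_fst.aemeasurable]
      refine (Finset.sum_congr rfl fun i _ => ?_).trans
        (Equiv.sum_comp σ fun i => (R i).map Prod.fst)
      exact Measure.fst_prod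
    · rw [Measure.map_finset_sum measurable_snd.aemeasurable,
        Measure.map_finset_sum measurable_snd.aemeasurable]
      exact Finset.sum_congr rfl fun i _ => Measure.snd_prod
  rw [integral_finsetSum_measure fun i _ => h_integrable _,
    integral_finsetSum_measure fun i _ => h_integrable _] at hQR
  have h₁ : ∀ i, c ((z (σ i)).1, (z i).2) - η ≤ ∫ p, c p ∂(Q i) := by
    intro i
    have : ∫ _, (c ((z (σ i)).1, (z i).2) - η) ∂(Q i) ≤ ∫ p, c p ∂(Q i) := by
      refine integral_mono_ae (integrable_const _) (h_integrable _) ?_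
      filter_upwards [hQmem i] with p hp
      linarith [(abs_lt.1 (hperm i p hp)).1]
    simpa using this
  have h₂ : ∀ i, ∫ p, c p ∂(R i) ≤ c (z i) + η := by
    intro i
    have : ∫ p, c p ∂(R i) ≤ ∫ _, (c (z i) + η) ∂(R i) := by
      refine integral_mono_ae (h_integrable _) (integrable_const _) ?_
      filter_upwards [hRmem i] with p hp
      linarith [(abs_lt.1 (hdiag i p hp)).2]
    simpa using this
  have h₃ := (Finset.sum_le_sum fun i (_ : i ∈ Finset.univ) => h₁ i).trans
    (hQR.trans (Finset.sum_le_sum fun i _ => h₂ i))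
  simp only [Finset.sum_sub_distrib, Finset.sum_add_distrib, Finset.sum_const,
    Finset.card_univ, Fintype.card_fin, nsmul_eq_mul] at h₃
  linarith

end Optimality

section Fibers

open ProbabilityTheory

/-- A measure concentrated on a set with almost surely trivial vertical fibers is concentrated on
the graph of a measurable map. -/
lemma exists_measurable_ae_eq_of_subsingleton_fiber {X F : Type*} [MeasurableSpace X]
    [NormedAddCommGroup F] [NormedSpace ℝ F] [CompleteSpace F] [SecondCountableTopology F]
    [MeasurableSpace F] [BorelSpace F] (P : Measure (X × F)) [IsFiniteMeasure P]
    {Γ : Set (X × F)} (hΓ : ∀ᵐ p ∂P, p ∈ Γ)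
    (hfib : ∀ᵐ x ∂P.fst, {y | (x, y) ∈ Γ}.Subsingleton) :
    ∃ T : X → F, Measurable T ∧ ∀ᵐ p ∂P, p.2 = T p.1 := by
  have hT : Measurable fun x => ∫ y, y ∂(P.condKernel x) :=
    (stronglyMeasurable_id.integral_kernel (κ := P.condKernel)).measurable
  refine ⟨_, hT, ?_⟩
  rw [← P.disintegrate P.condKernel] at hΓ
  have key : ∀ᵐ p ∂(P.fst ⊗ₘ P.condKernel), p.2 = ∫ y, y ∂(P.condKernel p.1) := by
    refine (Measure.ae_compProd_iff
      (measurableSet_eq_fun measurable_snd (hT.comp measurable_fst))).2 ?_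
    filter_upwards [hfib, Measure.ae_ae_of_ae_compProd hΓ] with x hx hxΓ
    obtain ⟨y₀, hy₀⟩ := hxΓ.exists
    have hy : ∀ᵐ y ∂(P.condKernel x), y = y₀ := by
      filter_upwards [hxΓ] with y hy using hx hy hy₀
    have hmean : ∫ y, y ∂(P.condKernel x) = y₀ := by
      rw [integral_congr_ae hy]
      simp
    simpa only [Function.comp_apply, hmean] using hy
  rwa [P.disintegrate P.condKernel] at key

end Fibers

section Existence

open Set

/-- Among the couplings of two probability measures on Polish spaces, some coupling maximizes the
integral of a given bounded continuous function. -/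
lemma exists_optimal_coupling {X Y : Type*} [TopologicalSpace X] [PolishSpace X]
    [MeasurableSpace X] [BorelSpace X] [TopologicalSpace Y] [PolishSpace Y] [MeasurableSpace Y]
    [BorelSpace Y] (μ : Measure X) (ν : Measure Y) [IsProbabilityMeasure μ]
    [IsProbabilityMeasure ν] {c : X × Y → ℝ} (hc : Continuous c) {M : ℝ}
    (hM : ∀ p, |c p| ≤ M) :
    ∃ P : Measure (X × Y), IsProbabilityMeasure P ∧ P.map Prod.fst = μ ∧ P.map Prod.snd = ν ∧
      ∀ P' : Measure (X × Y), IsProbabilityMeasure P' → P'.map Prod.fst = μ →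
        P'.map Prod.snd = ν → ∫ p, c p ∂P' ≤ ∫ p, c p ∂P := by
  let S : Set (ProbabilityMeasure (X × Y)) :=
    {P | P.map measurable_fst.aemeasurable = ⟨μ, inferInstance⟩} ∩
      {P | P.map measurable_snd.aemeasurable = ⟨ν, inferInstance⟩}
  have hS : ∀ P : ProbabilityMeasure (X × Y), P ∈ S ↔
      (P : Measure (X × Y)).map Prod.fst = μ ∧ (P : Measure (X × Y)).map Prod.snd = ν := by
    intro P
    exact and_congr Subtype.ext_iff Subtype.ext_iff
  have hclosed : IsClosed S :=
    (isClosed_eq (ProbabilityMeasure.continuous_map continuous_fst) continuous_const).inter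
      (isClosed_eq (ProbabilityMeasure.continuous_map continuous_snd) continuous_const)
  have htight :
      IsTightMeasureSet {((P : ProbabilityMeasure (X × Y)) : Measure (X × Y)) | P ∈ S} := by
    refine IsTightMeasureSet.prodMk ?_ ?_
    · refine (isTightMeasureSet_singleton (μ := μ)).subset ?_
      rintro _ ⟨_, ⟨P, hP, rfl⟩, rfl⟩
      exact ((hS P).1 hP).1
    · refine (isTightMeasureSet_singleton (μ := ν)).subset ?_
      rintro _ ⟨_, ⟨P, hP, rfl⟩, rfl⟩
      exact ((hS P).1 hP).2
  have hcompact : IsCompact S := by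
    have := isCompact_closure_of_isTightMeasureSet htight
    rwa [hclosed.closure_eq] at this
  have hne : S.Nonempty :=
    ⟨⟨μ.prod ν, inferInstance⟩, (hS _).2 ⟨by simp, by simp⟩⟩
  have hcont : Continuous fun P : ProbabilityMeasure (X × Y) => ∫ p, c p ∂(P : Measure (X × Y)) :=
    ProbabilityMeasure.continuous_integral_boundedContinuousFunction
      (BoundedContinuousFunction.ofNormedAddCommGroup c hc M hM)
  obtain ⟨P, hPS, hmax⟩ := hcompact.exists_isMaxOn hne hcont.continuousOn
  refine ⟨P, inferInstance, ((hS P).1 hPS).1, ((hS P).1 hPS).2, fun P' hP' h₁ h₂ => ?_⟩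
  exact hmax (show (⟨P', hP'⟩ : ProbabilityMeasure (X × Y)) ∈ S from (hS _).2 ⟨h₁, h₂⟩)

end Existence

section Twist

open Filter Topology Set

variable {E F : Type*} [NormedAddCommGroup E] [NormedSpace ℝ E] [FiniteDimensional ℝ E]
  [MeasurableSpace E] [BorelSpace E] [NormedAddCommGroup F] [NormedSpace ℝ F] [CompleteSpace F]
  [SecondCountableTopology F] [MeasurableSpace F] [BorelSpace F]

/-- Under the twist condition, the vertical fibers of a `c`-cyclically monotone set are almost all
trivial. -/
lemma IsCyclicallyMonotone.ae_subsingleton_fiber (μ : Measure E) [μ.IsAddHaarMeasure]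
    {Y : Type*} {c : E × Y → ℝ} {Γ : Set (E × Y)} (hΓ : IsCyclicallyMonotone c Γ)
    (hdiff : ∀ y, Differentiable ℝ (fun x => c (x, y)))
    (htwist : ∀ x, Function.Injective fun y => fderiv ℝ (fun t => c (t, y)) x) :
    ∀ᵐ x ∂μ, {y | (x, y) ∈ Γ}.Subsingleton := by
  obtain ⟨φ, hφ⟩ := hΓ.exists_potential
  have hsub : ∀ x y, (x, y) ∈ Γ →
      IsSubgradientWithinAt φ (fderiv ℝ (fun t => c (t, y)) x) (Prod.fst '' Γ) x := by
    intro x y hxy ε hε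
    filter_upwards [self_mem_nhdsWithin, nhdsWithin_le_nhds
      ((hdiff y x).hasFDerivAt.isLittleO.def hε)] with x' hx' hx'c
    have h₁ := hφ x y hxy x' hx'
    have h₂ := neg_le_of_abs_le ((Real.norm_eq_abs _).symm.le.trans hx'c)
    linarith
  filter_upwards [ae_isSubgradientWithinAt_unique μ φ (Prod.fst '' Γ)] with x hx y hy y' hy'
  exact htwist x (hx ⟨_, hy, rfl⟩ _ _ (hsub x y hy) (hsub x y' hy'))

/-- Under the twist condition, a maximizer of `∫ c` among the measures with the same marginals is
concentrated on the graph of a measurable map as soon as its first marginal is absolutely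
continuous. -/
lemma exists_measurable_ae_eq_of_optimal (μ : Measure E) [μ.IsAddHaarMeasure] {c : E × F → ℝ}
    (hc : Continuous c) {M : ℝ} (hM : ∀ p, |c p| ≤ M)
    (hdiff : ∀ y, Differentiable ℝ (fun x => c (x, y)))
    (htwist : ∀ x, Function.Injective fun y => fderiv ℝ (fun t => c (t, y)) x)
    {P : Measure (E × F)} [IsProbabilityMeasure P] (hac : P.fst ≪ μ)
    (hP : ∀ P' : Measure (E × F), IsProbabilityMeasure P' → P'.map Prod.fst = P.map Prod.fst →
      P'.map Prod.snd = P.map Prod.snd → ∫ p, c p ∂P' ≤ ∫ p, c p ∂P) :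
    ∃ T : E → F, Measurable T ∧ ∀ᵐ p ∂P, p.2 = T p.1 :=
  exists_measurable_ae_eq_of_subsingleton_fiber P Measure.support_mem_ae
    (hac.ae_le ((isCyclicallyMonotone_support_of_optimal hc hM hP).ae_subsingleton_fiber μ
      hdiff htwist))

end Twist

lemma eq_map_fst_of_ae_snd_eq {X Y : Type*} [MeasurableSpace X] [MeasurableSpace Y]
    {P : Measure (X × Y)} {T : X → Y} (hT : Measurable T) (h : ∀ᵐ p ∂P, p.2 = T p.1) :
    P = (P.map Prod.fst).map fun x => (x, T x) := by
  rw [Measure.map_map (by fun_prop) measurable_fst]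
  conv_lhs => rw [← Measure.map_id (μ := P)]
  refine Measure.map_congr ?_
  filter_upwards [h] with p hp
  exact Prod.ext rfl hp

/-- Brenier-type theorem under the twist condition: if `μ1` is absolutely continuous with
respect to Lebesgue measure and the bounded continuous cost `c` is differentiable in its first
variable with `s2 ↦ ∇_{s1} c(s1, s2)` injective for every `s1`, then there is a unique
maximizing coupling `P*`, and it is supported on the graph of a Borel map `T` pushing `μ1`
forward to `μ2`. -/
theorem brenier_twist {d : ℕ} (μ1 μ2 : Measure (EuclideanSpace ℝ (Fin d)))
    [IsProbabilityMeasure μ1] [IsProbabilityMeasure μ2]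
    (hac : μ1 ≪ (volume : Measure (EuclideanSpace ℝ (Fin d))))
    (c : EuclideanSpace ℝ (Fin d) × EuclideanSpace ℝ (Fin d) → ℝ)
    (hc : Continuous c) (hcb : ∃ M : ℝ, ∀ p, |c p| ≤ M)
    (hdiff : ∀ s2 : EuclideanSpace ℝ (Fin d), Differentiable ℝ (fun s1 => c (s1, s2)))
    (htwist : ∀ s1 : EuclideanSpace ℝ (Fin d),
      Function.Injective (fun s2 : EuclideanSpace ℝ (Fin d) =>
        fderiv ℝ (fun t => c (t, s2)) s1)) :
    ∃ (Pstar : Measure (EuclideanSpace ℝ (Fin d) × EuclideanSpace ℝ (Fin d)))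
      (T : EuclideanSpace ℝ (Fin d) → EuclideanSpace ℝ (Fin d)),
      Measurable T ∧
      Pstar = μ1.map (fun s1 => (s1, T s1)) ∧
      μ1.map T = μ2 ∧
      IsProbabilityMeasure Pstar ∧ IsCoupling μ1 μ2 Pstar ∧
      (∀ P : Measure (EuclideanSpace ℝ (Fin d) × EuclideanSpace ℝ (Fin d)),
        IsProbabilityMeasure P → IsCoupling μ1 μ2 P → ∫ p, c p ∂P ≤ ∫ p, c p ∂Pstar) ∧
      (∀ P : Measure (EuclideanSpace ℝ (Fin d) × EuclideanSpace ℝ (Fin d)),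
        IsProbabilityMeasure P → IsCoupling μ1 μ2 P →
        ∫ p, c p ∂P = ∫ p, c p ∂Pstar → P = Pstar) := by
  obtain ⟨M, hM⟩ := hcb
  have h_integrable : ∀ (ν : Measure (EuclideanSpace ℝ (Fin d) × EuclideanSpace ℝ (Fin d)))
      [IsFiniteMeasure ν], Integrable c ν := fun ν _ =>
    Integrable.of_bound hc.measurable.aestronglyMeasurable M (ae_of_all _ hM)
  have hgraph : ∀ P : Measure (EuclideanSpace ℝ (Fin d) × EuclideanSpace ℝ (Fin d)),
      IsProbabilityMeasure P → P.map Prod.fst = μ1 → P.map Prod.snd = μ2 →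
      (∀ P' : Measure (EuclideanSpace ℝ (Fin d) × EuclideanSpace ℝ (Fin d)),
        IsProbabilityMeasure P' → P'.map Prod.fst = μ1 → P'.map Prod.snd = μ2 →
        ∫ p, c p ∂P' ≤ ∫ p, c p ∂P) →
      ∃ T : EuclideanSpace ℝ (Fin d) → EuclideanSpace ℝ (Fin d),
        Measurable T ∧ ∀ᵐ p ∂P, p.2 = T p.1 := by
    rintro P _ rfl rfl hP
    exact exists_measurable_ae_eq_of_optimal volume hc hM hdiff htwist hac hP
  obtain ⟨P, hprob, hP₁, hP₂, hP⟩ := exists_optimal_coupling μ1 μ2 hc hM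
  obtain ⟨T, hT, hPT⟩ := hgraph P hprob hP₁ hP₂ hP
  have hPeq : P = μ1.map fun x => (x, T x) := hP₁ ▸ eq_map_fst_of_ae_snd_eq hT hPT
  refine ⟨P, T, hT, hPeq, ?_, hprob, ⟨hP₁, hP₂⟩, fun P' h h' => hP P' h h'.1 h'.2, ?_⟩
  · rw [← hP₂, hPeq, Measure.map_map measurable_snd (by fun_prop)]
    rfl
  -- The midpoint of two maximizers is a maximizer, so both live on the same graph.
  rintro P' hprob' ⟨hP'₁, hP'₂⟩ heq
  have hhalf : (2⁻¹ : NNReal) + 2⁻¹ = 1 := by norm_num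
  let N := (2⁻¹ : NNReal) • P + (2⁻¹ : NNReal) • P'
  have hN₁ : N.map Prod.fst = μ1 := by
    rw [Measure.map_add _ _ measurable_fst, Measure.map_smul, Measure.map_smul, hP₁, hP'₁,
      ← add_smul, hhalf, one_smul]
  have hN₂ : N.map Prod.snd = μ2 := by
    rw [Measure.map_add _ _ measurable_snd, Measure.map_smul, Measure.map_smul, hP₂, hP'₂,
      ← add_smul, hhalf, one_smul]
  have hNprob : IsProbabilityMeasure N := by
    have : IsProbabilityMeasure (N.map Prod.fst) := hN₁ ▸ inferInstance
    exact Measure.isProbabilityMeasure_of_map Prod.fst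
  have hNint : ∫ p, c p ∂N = ∫ p, c p ∂P := by
    rw [integral_add_measure (h_integrable _) (h_integrable _), integral_smul_nnreal_measure,
      integral_smul_nnreal_measure, heq, ← add_smul, hhalf, one_smul]
  obtain ⟨T', hT', hNT'⟩ := hgraph N hNprob hN₁ hN₂ (hNint ▸ hP)
  rw [ae_add_measure_iff, Measure.ae_smul_measure_iff (by norm_num),
    Measure.ae_smul_measure_iff (by norm_num)] at hNT'
  rw [eq_map_fst_of_ae_snd_eq hT' hNT'.1, eq_map_fst_of_ae_snd_eq hT' hNT'.2, hP₁, hP'₁]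
end
end

section
/- Infinite relative entropy of a low-dimensional generative model: let l < d, let T̂ : ℝ^l → ℝ^d be a Lipschitz map, let μ0 be a Borel probability measure on ℝ^l, and let ν be a Borel probability measure on ℝ^d absolutely continuous with respect to Lebesgue measure. Then the pushforward T̂_#μ0 is not absolutely continuous with respect to ν, and the Kullback–Leibler divergence KL(T̂_#μ0 ‖ ν) = +∞. -/
open MeasureTheory
open scoped NNReal Classical

noncomputable section

/-- The Kullback–Leibler divergence of probability measures: `∫ log(dμ/dν) dμ` if `μ ≪ ν`,
and `+∞` otherwise. -/
def klDivergence {α : Type*} [MeasurableSpace α] (μ ν : Measure α) : EReal :=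
  if μ ≪ ν then ((∫ x, Real.log ((μ.rnDeriv ν x).toReal) ∂μ : ℝ) : EReal) else ⊤

/-- A Lipschitz map into a space of larger dimension has null range. -/
theorem LipschitzWith.addHaar_range_eq_zero {E F : Type*}
    [NormedAddCommGroup E] [NormedSpace ℝ E] [FiniteDimensional ℝ E]
    [NormedAddCommGroup F] [NormedSpace ℝ F] [FiniteDimensional ℝ F]
    [MeasurableSpace F] [BorelSpace F] (μ : Measure F) [μ.IsAddHaarMeasure]
    {f : E → F} {K : ℝ≥0} (hf : LipschitzWith K f)
    (hEF : Module.finrank ℝ E < Module.finrank ℝ F) : μ (Set.range f) = 0 := by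
  have hdim : dimH (Set.range f) < ((Module.finrank ℝ F : ℝ≥0) : ENNReal) := by
    refine hf.dimH_range_le.trans_lt ?_
    rw [Real.dimH_univ_eq_finrank]
    exact_mod_cast hEF
  have hnull : Measure.hausdorffMeasure (Module.finrank ℝ F : ℝ) (Set.range f) = 0 := by
    simpa using hausdorffMeasure_of_dimH_lt hdim
  exact Measure.absolutelyContinuous_isAddHaarMeasure μ _ hnull

/-- Infinite relative entropy of a low-dimensional generative model: if `l < d`, `T̂ : ℝ^l → ℝ^d`
is Lipschitz, `μ0` is a probability measure on `ℝ^l` and `ν` is a probability measure on `ℝ^d`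
absolutely continuous with respect to Lebesgue measure, then `T̂_#μ0` is not absolutely
continuous with respect to `ν` and `KL(T̂_#μ0 ‖ ν) = +∞`. -/
theorem kl_pushforward_infinite {l d : ℕ} (hld : l < d)
    (That : EuclideanSpace ℝ (Fin l) → EuclideanSpace ℝ (Fin d))
    (K : ℝ≥0) (hT : LipschitzWith K That)
    (μ0 : Measure (EuclideanSpace ℝ (Fin l))) [IsProbabilityMeasure μ0]
    (ν : Measure (EuclideanSpace ℝ (Fin d))) [IsProbabilityMeasure ν]
    (hν : ν ≪ (volume : Measure (EuclideanSpace ℝ (Fin d)))) :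
    ¬ (μ0.map That ≪ ν) ∧ klDivergence (μ0.map That) ν = ⊤ := by
  have hnac : ¬ (μ0.map That ≪ ν) := by
    intro hac
    have hnull : μ0.map That (Set.range That) = 0 :=
      hac (hν (hT.addHaar_range_eq_zero volume (by simpa using hld)))
    have hpre := Measure.preimage_null_of_map_null
      hT.continuous.measurable.aemeasurable hnull
    simp at hpre
  exact ⟨hnac, if_neg hnac⟩
end
end

section
/- Squared 2-Wasserstein distance between isotropic centered Gaussians: for σ2 ≥ σ1 > 0 and d ≥ 1, the infimum over all couplings P of the Gaussian measures N(0, σ1² I_d) and N(0, σ2² I_d) on ℝ^d of ∫ |s1 − s2|² dP(s1, s2) equals d (σ2 − σ1)². -/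
open MeasureTheory ProbabilityTheory
open scoped NNReal

noncomputable section

/-- The isotropic centered Gaussian measure `N(0, σ² I_d)` on `ℝ^d`, as a product of
one-dimensional Gaussians. -/
def isoGaussian (d : ℕ) (σ : ℝ≥0) : Measure (Fin d → ℝ) :=
  Measure.pi (fun _ : Fin d => gaussianReal 0 (σ ^ 2))

/-- The second moment of a coordinate whose law is a marginal of the isotropic Gaussian. -/
lemma integrable_and_integral_sq_of_map_eq_isoGaussian {Ω : Type*} [MeasurableSpace Ω]
    {P : Measure Ω} {d : ℕ} {σ : ℝ≥0} {X : Ω → Fin d → ℝ} (hX : Measurable X)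
    (h : P.map X = isoGaussian d σ) (i : Fin d) :
    Integrable (fun ω => X ω i ^ 2) P ∧ ∫ ω, X ω i ^ 2 ∂P = (σ : ℝ) ^ 2 := by
  have hXi : MeasurePreserving (fun ω => X ω i) P (gaussianReal 0 (σ ^ 2)) :=
    (measurePreserving_eval (fun _ : Fin d => gaussianReal 0 (σ ^ 2)) i).comp ⟨hX, h⟩
  have hint : Integrable (fun x : ℝ => x ^ 2) (gaussianReal 0 (σ ^ 2)) :=
    (memLp_id_gaussianReal 2).integrable_sq
  refine ⟨hXi.integrable_comp_of_integrable hint, ?_⟩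
  have hvar := variance_of_integral_eq_zero (μ := gaussianReal 0 (σ ^ 2)) (X := fun x : ℝ => x)
    aemeasurable_id integral_id_gaussianReal
  rw [variance_fun_id_gaussianReal] at hvar
  have hmap := integral_map (μ := P) hXi.measurable.aemeasurable
    (f := fun x : ℝ => x ^ 2) (by fun_prop)
  rw [hXi.map_eq, ← hvar] at hmap
  simpa using hmap.symm

/-- Scaling an isotropic Gaussian multiplies its standard deviation. -/
lemma map_smul_isoGaussian (d : ℕ) (c σ : ℝ≥0) :
    (isoGaussian d σ).map (fun x i => (c : ℝ) * x i) = isoGaussian d (c * σ) := by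
  unfold isoGaussian
  rw [Measure.pi_map_pi (f := fun _ x => (c : ℝ) * x) (fun _ => by fun_prop)]
  congr 1
  ext1 i
  rw [gaussianReal_map_const_mul]
  congr 1
  · simp
  · ext
    simp [mul_pow]

/-- Weighted Young inequality in the form giving the optimal linear transport bound. -/
lemma one_sub_mul_sq_add_le_sub_sq {c : ℝ} (hc : 0 < c) (a b : ℝ) :
    (1 - c) * a ^ 2 + (1 - c⁻¹) * b ^ 2 ≤ (a - b) ^ 2 := by
  have h : (a - b) ^ 2 - ((1 - c) * a ^ 2 + (1 - c⁻¹) * b ^ 2) = c⁻¹ * (c * a - b) ^ 2 := by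
    field_simp
    ring
  have : 0 ≤ c⁻¹ * (c * a - b) ^ 2 := by positivity
  linarith

/-- Squared 2-Wasserstein distance between isotropic centered Gaussians: the infimum of
`∫ |s1 - s2|² dP` over couplings of `N(0, σ1² I_d)` and `N(0, σ2² I_d)` equals
`d (σ2 - σ1)²`. -/
theorem wasserstein2_gaussian (d : ℕ) (hd : 1 ≤ d) (σ1 σ2 : ℝ≥0)
    (hσ1 : 0 < σ1) (hσ12 : σ1 ≤ σ2) :
    sInf {r : ℝ | ∃ P : Measure ((Fin d → ℝ) × (Fin d → ℝ)), IsProbabilityMeasure P ∧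
        P.map Prod.fst = isoGaussian d σ1 ∧ P.map Prod.snd = isoGaussian d σ2 ∧
        r = ∫ p, ∑ i, (p.1 i - p.2 i) ^ 2 ∂P} =
      (d : ℝ) * ((σ2 : ℝ) - (σ1 : ℝ)) ^ 2 := by
  have hσ2 : 0 < σ2 := hσ1.trans_le hσ12
  have h1 : (0 : ℝ) < σ1 := hσ1
  have h2 : (0 : ℝ) < σ2 := hσ2
  refine IsLeast.csInf_eq ⟨?_, ?_⟩
  · have hpi : IsProbabilityMeasure (isoGaussian d σ1) := by
      unfold isoGaussian
      infer_instance
    have hm : Measurable fun x : Fin d → ℝ =>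
        (x, fun i => ((σ2 / σ1 : ℝ≥0) : ℝ) * x i) := by fun_prop
    refine ⟨(isoGaussian d σ1).map fun x => (x, fun i => ((σ2 / σ1 : ℝ≥0) : ℝ) * x i),
      Measure.isProbabilityMeasure_map hm.aemeasurable, ?_, ?_, ?_⟩
    · rw [Measure.map_map measurable_fst hm]
      exact Measure.map_id
    · rw [Measure.map_map measurable_snd hm]
      refine (map_smul_isoGaussian d (σ2 / σ1) σ1).trans ?_
      rw [div_mul_cancel₀ _ hσ1.ne']
    · have hmom := integrable_and_integral_sq_of_map_eq_isoGaussian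
        (P := isoGaussian d σ1) measurable_id Measure.map_id
      have hsq : ∀ (x : Fin d → ℝ) (i : Fin d),
          (x i - ((σ2 / σ1 : ℝ≥0) : ℝ) * x i) ^ 2 = (1 - (σ2 / σ1 : ℝ)) ^ 2 * id x i ^ 2 := by
        intro x i
        push_cast
        simp only [id]
        ring
      rw [integral_map hm.aemeasurable
        (Measurable.aestronglyMeasurable (by fun_prop))]
      simp only [hsq]
      rw [integral_finsetSum _ fun i _ => (hmom i).1.const_mul _]
      simp only [integral_const_mul, (hmom _).2, Finset.sum_const, Finset.card_univ,
        Fintype.card_fin, nsmul_eq_mul]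
      field_simp
      ring
  · rintro r ⟨P, -, hP1, hP2, rfl⟩
    have hX := integrable_and_integral_sq_of_map_eq_isoGaussian measurable_fst hP1
    have hY := integrable_and_integral_sq_of_map_eq_isoGaussian measurable_snd hP2
    have hint : ∀ i, Integrable
        (fun p : (Fin d → ℝ) × (Fin d → ℝ) => (p.1 i - p.2 i) ^ 2) P := by
      intro i
      refine (((hX i).1.add (hY i).1).const_mul 2).mono'
        (Measurable.aestronglyMeasurable (by fun_prop)) (ae_of_all _ fun p => ?_)
      rw [Real.norm_of_nonneg (sq_nonneg _)]
      simp only [Pi.add_apply]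
      nlinarith [sq_nonneg (p.1 i + p.2 i)]
    have hle : ∀ i, ((σ2 : ℝ) - σ1) ^ 2 ≤ ∫ p, (p.1 i - p.2 i) ^ 2 ∂P := by
      intro i
      have hX' := (hX i).1.const_mul (1 - (σ2 / σ1 : ℝ))
      have hY' := (hY i).1.const_mul (1 - (σ2 / σ1 : ℝ)⁻¹)
      have hmono := integral_mono (hX'.add hY') (hint i)
        fun p => one_sub_mul_sq_add_le_sub_sq (div_pos h2 h1) (p.1 i) (p.2 i)
      rw [integral_add' hX' hY', integral_const_mul, integral_const_mul,
        (hX i).2, (hY i).2] at hmono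
      refine le_of_eq_of_le ?_ hmono
      field_simp
      ring
    rw [integral_finsetSum _ fun i _ => hint i]
    simpa using Finset.sum_le_sum fun i (_ : i ∈ Finset.univ) => hle i
end
end
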